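/- arXiv:1807.11525 — 2 statements merged into one kernel-verified Lean document; each statement's English description precedes it below -/
import Mathlib

section
/- Let E be a Banach space, (β_t)_{t∈ℝ} a strongly continuous one-parameter group of contractions on E, and δ its infinitesimal generator. Then every nonzero real number λ belongs to the resolvent set of δ: the map λI − δ : D(δ) → E is a bijection and its inverse is a bounded operator with ‖(λI − δ)^{−1}(b)‖ ≤ (1/|λ|) ‖b‖ for all b ∈ E. -/
open Filter Topology MeasureTheory

lemma aux_bound {E : Type*} [NormedAddCommGroup E] [NormedSpace ℝ E]
    (β : ℝ → E →L[ℝ] E)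
    (hβcontr : ∀ (t : ℝ) (a : E), ‖β t a‖ ≤ ‖a‖) (lam : ℝ) (hlam : 0 < lam) (x w : E)
    (hw : Tendsto (fun h : ℝ => h⁻¹ • (β h x - x)) (𝓝[≠] 0) (𝓝 w)) :
    lam * ‖x‖ ≤ ‖lam • x - w‖ := by
  have h1 : Tendsto (fun h : ℝ => ‖lam • x - h⁻¹ • (β h x - x)‖) (𝓝[>] 0) (𝓝 ‖lam • x - w‖) :=
    ((tendsto_const_nhds.sub hw).norm).mono_left
      (nhdsWithin_mono _ (fun y (hy : 0 < y) => hy.ne'))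
  refine ge_of_tendsto h1 ?_
  filter_upwards [self_mem_nhdsWithin] with h hh
  have hh : 0 < h := hh
  have hi : 0 < h⁻¹ := inv_pos.mpr hh
  have e : lam • x - h⁻¹ • (β h x - x) = (lam + h⁻¹) • x - h⁻¹ • β h x := by module
  rw [e]
  have h2 := norm_sub_norm_le ((lam + h⁻¹) • x) (h⁻¹ • β h x)
  rw [norm_smul, norm_smul, Real.norm_of_nonneg (by positivity), Real.norm_of_nonneg hi.le] at h2
  have h3 := mul_le_mul_of_nonneg_left (hβcontr h x) hi.le
  linarith

lemma aux_exists {E : Type*} [NormedAddCommGroup E] [NormedSpace ℝ E] [CompleteSpace E]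
    (β : ℝ → E →L[ℝ] E)
    (hβ0 : β 0 = ContinuousLinearMap.id ℝ E)
    (hβadd : ∀ t s : ℝ, β (t + s) = (β t).comp (β s))
    (hβcontr : ∀ (t : ℝ) (a : E), ‖β t a‖ ≤ ‖a‖)
    (hβcont : ∀ a : E, Continuous fun t : ℝ => β t a) (lam : ℝ) (hlam : 0 < lam) (b : E) :
    ∃ x : E, Tendsto (fun h : ℝ => h⁻¹ • (β h x - x)) (𝓝[≠] 0) (𝓝 (lam • x - b)) := by
  set g : ℝ → E := fun t => Real.exp (-lam * t) • β t b with hg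
  have hgc : Continuous g := by
    have := hβcont b
    fun_prop
  have hgi : ∀ c, IntegrableOn g (Set.Ioi c) := by
    intro c
    refine Integrable.mono' ((integrableOn_exp_mul_Ioi (neg_lt_zero.mpr hlam) c).mul_const ‖b‖)
      hgc.aestronglyMeasurable (Eventually.of_forall fun t => ?_)
    rw [hg]
    simp only [norm_smul, Real.norm_eq_abs, Real.abs_exp]
    exact mul_le_mul_of_nonneg_left (hβcontr t b) (Real.exp_pos _).le
  set x : E := ∫ t in Set.Ioi 0, g t with hx
  have key : ∀ h, β h x = Real.exp (lam * h) • (x - ∫ t in (0:ℝ)..h, g t) := by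
    intro h
    have e1 : x - ∫ t in (0:ℝ)..h, g t = ∫ t in Set.Ioi h, g t := by
      rw [hx, ← intervalIntegral.integral_interval_add_Ioi (hgi 0) (hgi h)]; abel
    have e2 : ∫ t in Set.Ioi 0, g (t + h) = ∫ t in Set.Ioi h, g t := by
      have := (measurePreserving_add_right (volume : Measure ℝ) h).setIntegral_preimage_emb
        (measurableEmbedding_addRight h) g (Set.Ioi h)
      simpa using this
    rw [e1, ← e2, ← integral_smul, hx, ← ContinuousLinearMap.integral_comp_comm _ (hgi 0)]
    congr 1
    ext t
    simp only [hg, map_smul, smul_smul, ← Real.exp_add]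
    rw [add_comm t h, hβadd, ContinuousLinearMap.comp_apply]
    congr 2
    ring
  refine ⟨x, ?_⟩
  have hd : HasDerivAt (fun h => β h x) (lam • x - b) 0 := by
    have d1 : HasDerivAt (fun h => x - ∫ t in (0:ℝ)..h, g t) (-(g 0)) 0 :=
      ((hgc.integral_hasStrictDerivAt 0 0).hasDerivAt).const_sub x
    have d2 : HasDerivAt (fun h => Real.exp (lam * h)) (Real.exp (lam * 0) * (lam * 1)) 0 :=
      ((hasDerivAt_id (0:ℝ)).const_mul lam).exp
    have d3 := d2.fun_smul d1
    rw [funext key]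
    convert d3 using 1
    simp [hg, hβ0]
    abel
  have := hasDerivAt_iff_tendsto_slope_zero.mp hd
  simpa [hβ0] using this

lemma aux_pos {E : Type*} [NormedAddCommGroup E] [NormedSpace ℝ E] [CompleteSpace E]
    (β : ℝ → E →L[ℝ] E)
    (hβ0 : β 0 = ContinuousLinearMap.id ℝ E)
    (hβadd : ∀ t s : ℝ, β (t + s) = (β t).comp (β s))
    (hβcontr : ∀ (t : ℝ) (a : E), ‖β t a‖ ≤ ‖a‖)
    (hβcont : ∀ a : E, Continuous fun t : ℝ => β t a)
    (D : Set E) (δ : E → E)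
    (hD : ∀ x : E, x ∈ D ↔
      ∃ w : E, Tendsto (fun h : ℝ => h⁻¹ • (β h x - x)) (𝓝[≠] 0) (𝓝 w))
    (hδ : ∀ x ∈ D, Tendsto (fun h : ℝ => h⁻¹ • (β h x - x)) (𝓝[≠] 0) (𝓝 (δ x)))
    (lam : ℝ) (hlam : 0 < lam) :
    (∀ b : E, ∃! x : E, x ∈ D ∧ lam • x - δ x = b) ∧
      ∀ x ∈ D, ‖x‖ ≤ (1 / |lam|) * ‖lam • x - δ x‖ := by
  refine ⟨fun b => ?_, fun x hx => ?_⟩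
  · obtain ⟨x, hx⟩ := aux_exists β hβ0 hβadd hβcontr hβcont lam hlam b
    have hxD : x ∈ D := (hD x).mpr ⟨_, hx⟩
    have hxe : δ x = lam • x - b := tendsto_nhds_unique (hδ x hxD) hx
    refine ⟨x, ⟨hxD, by rw [hxe]; abel⟩, ?_⟩
    rintro y ⟨hyD, hy⟩
    have hs : Tendsto (fun h : ℝ => h⁻¹ • (β h (y - x) - (y - x))) (𝓝[≠] 0) (𝓝 (δ y - δ x)) := by
      refine ((hδ y hyD).sub (hδ x hxD)).congr fun h => ?_
      rw [map_sub]; module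
    have h1 := aux_bound β hβcontr lam hlam _ _ hs
    have h2 : lam • (y - x) - (δ y - δ x) = 0 := by
      have : lam • (y - x) - (δ y - δ x) = (lam • y - δ y) - (lam • x - δ x) := by module
      rw [this, hy, hxe]; abel
    rw [h2, norm_zero] at h1
    have h3 : ‖y - x‖ ≤ 0 := by
      by_contra hc
      have := mul_pos hlam (not_le.mp hc)
      linarith
    exact sub_eq_zero.mp (norm_le_zero_iff.mp h3)
  · have h1 := aux_bound β hβcontr lam hlam _ _ (hδ x hx)
    rw [abs_of_pos hlam, one_div, inv_mul_eq_div, le_div_iff₀ hlam]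
    linarith

lemma aux_reflect {E : Type*} [NormedAddCommGroup E] [NormedSpace ℝ E]
    (β : ℝ → E →L[ℝ] E) (x w : E)
    (hw : Tendsto (fun h : ℝ => h⁻¹ • (β h x - x)) (𝓝[≠] 0) (𝓝 w)) :
    Tendsto (fun h : ℝ => h⁻¹ • (β (-h) x - x)) (𝓝[≠] 0) (𝓝 (-w)) := by
  have hn : Tendsto (fun h : ℝ => -h) (𝓝[≠] 0) (𝓝[≠] 0) := by
    refine tendsto_nhdsWithin_iff.mpr ⟨?_, ?_⟩
    · have : Tendsto (fun h : ℝ => -h) (𝓝 0) (𝓝 (-0)) := continuous_neg.tendsto 0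
      rw [neg_zero] at this
      exact this.mono_left nhdsWithin_le_nhds
    · filter_upwards [self_mem_nhdsWithin] with h hh
      simpa using hh
  refine (hw.comp hn).neg.congr fun h => ?_
  simp only [Function.comp, inv_neg, neg_smul, neg_neg]

theorem stmt_9 {E : Type*} [NormedAddCommGroup E] [NormedSpace ℝ E] [CompleteSpace E]
    (β : ℝ → E →L[ℝ] E)
    (hβ0 : β 0 = ContinuousLinearMap.id ℝ E)
    (hβadd : ∀ t s : ℝ, β (t + s) = (β t).comp (β s))
    (hβcontr : ∀ (t : ℝ) (a : E), ‖β t a‖ ≤ ‖a‖)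
    (hβcont : ∀ a : E, Continuous fun t : ℝ => β t a)
    (D : Set E) (δ : E → E)
    (hD : ∀ x : E, x ∈ D ↔
      ∃ w : E, Tendsto (fun h : ℝ => h⁻¹ • (β h x - x)) (𝓝[≠] 0) (𝓝 w))
    (hδ : ∀ x ∈ D, Tendsto (fun h : ℝ => h⁻¹ • (β h x - x)) (𝓝[≠] 0) (𝓝 (δ x)))
    (lam : ℝ) (hlam : lam ≠ 0) :
    (∀ b : E, ∃! x : E, x ∈ D ∧ lam • x - δ x = b) ∧
      ∀ x ∈ D, ‖x‖ ≤ (1 / |lam|) * ‖lam • x - δ x‖ := by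
  rcases lt_or_gt_of_ne hlam with hneg | hpos
  · have hp : 0 < -lam := neg_pos.mpr hneg
    have hA := aux_pos (fun t => β (-t)) (by simpa using hβ0)
      (fun t s => by rw [← hβadd, neg_add]) (fun t a => hβcontr (-t) a)
      (fun a => (hβcont a).comp continuous_neg) D (fun x => -δ x)
      (fun x => by
        rw [hD]
        refine ⟨fun ⟨w, hw⟩ => ⟨-w, aux_reflect β x w hw⟩, fun ⟨w, hw⟩ => ⟨-w, ?_⟩⟩
        simpa using aux_reflect (fun t => β (-t)) x w hw)
      (fun x hx => aux_reflect β x _ (hδ x hx)) (-lam) hp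
    have e : ∀ x : E, (-lam) • x - -δ x = -(lam • x - δ x) := fun x => by module
    simp only [e, abs_neg, norm_neg] at hA
    refine ⟨fun b => ?_, hA.2⟩
    simpa only [neg_inj] using hA.1 (-b)
  · exact aux_pos β hβ0 hβadd hβcontr hβcont D δ hD hδ lam hpos
end

section
/- Let E be a Banach space, (β_t)_{t∈ℝ} a strongly continuous one-parameter group of contractions on E, and δ its infinitesimal generator. Then for every a ∈ D(δ) and every real number λ: ‖δ(a) − λ a‖ ≥ |λ| ‖a‖. -/
open Filter Topology MeasureTheory

theorem stmt_10 {E : Type*} [NormedAddCommGroup E] [NormedSpace ℝ E] [CompleteSpace E]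
    (β : ℝ → E →L[ℝ] E)
    (hβ0 : β 0 = ContinuousLinearMap.id ℝ E)
    (hβadd : ∀ t s : ℝ, β (t + s) = (β t).comp (β s))
    (hβcontr : ∀ (t : ℝ) (a : E), ‖β t a‖ ≤ ‖a‖)
    (hβcont : ∀ a : E, Continuous fun t : ℝ => β t a)
    (D : Set E) (δ : E → E)
    (hD : ∀ x : E, x ∈ D ↔
      ∃ w : E, Tendsto (fun h : ℝ => h⁻¹ • (β h x - x)) (𝓝[≠] 0) (𝓝 w))
    (hδ : ∀ x ∈ D, Tendsto (fun h : ℝ => h⁻¹ • (β h x - x)) (𝓝[≠] 0) (𝓝 (δ x)))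
    (a : E) (ha : a ∈ D) (lam : ℝ) :
    |lam| * ‖a‖ ≤ ‖δ a - lam • a‖ := by
  have key : ∀ h : ℝ, h ≠ 0 → 0 ≤ h * lam →
      |lam| * ‖a‖ ≤ ‖h⁻¹ • (β h a - a) - lam • a‖ := by
    intro h hh hl
    have e : h⁻¹ • (β h a - a) - lam • a = h⁻¹ • (β h a - (1 + h * lam) • a) := by
      rw [add_smul, one_smul, mul_smul, ← sub_sub, smul_sub h⁻¹ (β h a - a), inv_smul_smul₀ hh]
    have hp : 0 < |h| := abs_pos.mpr hh
    rw [e, norm_smul, norm_inv, Real.norm_eq_abs, inv_mul_eq_div, le_div_iff₀ hp]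
    have h1 := norm_sub_norm_le ((1 + h * lam) • a) (β h a)
    rw [norm_sub_rev, norm_smul, Real.norm_eq_abs, abs_of_nonneg (by linarith)] at h1
    have h2 := hβcontr h a
    have h3 : |lam| * |h| = h * lam := by
      rw [← abs_mul, mul_comm, abs_of_nonneg hl]
    calc |lam| * ‖a‖ * |h| = (|lam| * |h|) * ‖a‖ := by ring
      _ = h * lam * ‖a‖ := by rw [h3]
      _ ≤ _ := by linarith
  have T := ((hδ a ha).sub_const (lam • a)).norm
  rcases le_total 0 lam with hl | hl
  · refine ge_of_tendsto (T.mono_left (nhdsWithin_mono 0 (s := Set.Ioi 0) ?_)) ?_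
    · intro x hx
      exact ne_of_gt hx
    · filter_upwards [self_mem_nhdsWithin] with h hh
      exact key h (ne_of_gt hh) (mul_nonneg (le_of_lt hh) hl)
  · refine ge_of_tendsto (T.mono_left (nhdsWithin_mono 0 (s := Set.Iio 0) ?_)) ?_
    · intro x hx
      exact ne_of_lt hx
    · filter_upwards [self_mem_nhdsWithin] with h hh
      exact key h (ne_of_lt hh) (mul_nonneg_of_nonpos_of_nonpos (le_of_lt hh) hl)
end
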